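/- From the position P4, placing a chap at f7 is Alfred's unique non-losing move: after Alfred places a chap at f7, Betty has no winning strategy from the resulting position, while after every other legal move of Alfred from P4, Betty has a winning strategy from the resulting position. -/

import Mathlib

/-!
Formalization of Philosophers' Phutball on an `m × n` board (`m` rows, `n` columns).
Points are pairs `(column, row)` of integers, with columns `1, …, n` (a, b, c, …)
and rows `1, …, m` (bottom to top).  Player `true` is Alfred (first player, aims
for the top row `m`); player `false` is Betty (aims for the bottom row `1`).
-/

/-- A player: `true` is Alfred, `false` is Betty. -/
abbrev Player := Bool

/-- A Phutball position: the ball's point `(column, row)`, the finite set of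
chaps, and the player whose turn it is. -/
structure PState where
  ball : ℤ × ℤ
  chaps : Finset (ℤ × ℤ)
  turn : Player
deriving DecidableEq

/-- The eight horizontal, vertical and diagonal directions. -/
def dirs : Finset (ℤ × ℤ) :=
  {(1, 0), (1, 1), (0, 1), (-1, 1), (-1, 0), (-1, -1), (0, -1), (1, -1)}

/-- The point reached from `b` after `i` steps in direction `d`. -/
def ray (b d : ℤ × ℤ) (i : ℤ) : ℤ × ℤ := (b.1 + i * d.1, b.2 + i * d.2)

/-- A point is on the `m × n` board. -/
def OnBoard (m n : ℤ) (p : ℤ × ℤ) : Prop :=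
  1 ≤ p.1 ∧ p.1 ≤ n ∧ 1 ≤ p.2 ∧ p.2 ≤ m

/-- A single hop on a board with `n` columns: the ball at `b` moves in one of the
eight directions `d` over a contiguous nonempty line of `k` chaps, landing on the
first point beyond them that carries no chap; the jumped-over chaps are removed.
The landing point must not lie onto or past the sidelines (outside columns
`1, …, n`), but it may lie past the top or bottom row. -/
def Hop (n : ℤ) (b : ℤ × ℤ) (c : Finset (ℤ × ℤ)) (b' : ℤ × ℤ) (c' : Finset (ℤ × ℤ)) : Prop :=
  ∃ d ∈ dirs, ∃ k : ℕ, 1 ≤ k ∧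
    (∀ i : ℕ, 1 ≤ i → i ≤ k → ray b d i ∈ c) ∧
    ray b d (k + 1) ∉ c ∧
    1 ≤ (ray b d (k + 1)).1 ∧ (ray b d (k + 1)).1 ≤ n ∧
    b' = ray b d (k + 1) ∧
    c' = c \ Finset.image (fun i : ℕ => ray b d i) (Finset.Icc 1 k)

/-- A jump is a nonempty sequence of hops (the player may stop after any hop,
and the removed chaps cannot be re-used by later hops of the same jump).  The
jump can continue after a hop only if the ball has not been carried past the top
or bottom row (which would end the game immediately). -/
inductive Jump (m n : ℤ) : ℤ × ℤ → Finset (ℤ × ℤ) → ℤ × ℤ → Finset (ℤ × ℤ) → Prop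
  | single {b c b' c'} : Hop n b c b' c' → Jump m n b c b' c'
  | cons {b c b₁ c₁ b' c'} : Hop n b c b₁ c₁ → 1 ≤ b₁.2 → b₁.2 ≤ m →
      Jump m n b₁ c₁ b' c' → Jump m n b c b' c'

/-- The winner, if any, of a position (evaluated between turns): Alfred wins if
the ball rests on the top row `m` or has been carried past it; Betty wins if the
ball rests on the bottom row `1` or has been carried past it. -/
def winner (m : ℤ) (s : PState) : Option Player :=
  if m ≤ s.ball.2 then some true else if s.ball.2 ≤ 1 then some false else none

/-- A single legal move on the `m × n` board: the player to move either places a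
chap on a vacant on-board point, or moves the ball by a jump; the turn passes to
the other player. -/
def MoveRel (m n : ℤ) (s t : PState) : Prop :=
  t.turn = !s.turn ∧
    ((∃ p, OnBoard m n p ∧ p ∉ s.chaps ∧ p ≠ s.ball ∧
        t.ball = s.ball ∧ t.chaps = insert p s.chaps) ∨
      Jump m n s.ball s.chaps t.ball t.chaps)

/-- An infinite record of play: while the game is not over and a legal move
exists, a legal move is made; otherwise the position is frozen forever. -/
def IsPlay (m n : ℤ) (f : ℕ → PState) : Prop :=
  ∀ k,
    (winner m (f k) = none ∧ (∃ t, MoveRel m n (f k) t) ∧ MoveRel m n (f k) (f (k + 1))) ∨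
    ((winner m (f k) ≠ none ∨ ¬ ∃ t, MoveRel m n (f k) t) ∧ f (k + 1) = f k)

/-- A strategy for player `p` that always proposes a legal move whenever the game
is not over, it is `p`'s turn, and some legal move exists. -/
def LegalStrategy (m n : ℤ) (p : Player) (σ : PState → PState) : Prop :=
  ∀ s, s.turn = p → winner m s = none → (∃ t, MoveRel m n s t) → MoveRel m n s (σ s)

/-- The play `f` follows the strategy `σ` of player `p`. -/
def Follows (m n : ℤ) (p : Player) (σ : PState → PState) (f : ℕ → PState) : Prop :=
  ∀ k, (f k).turn = p → winner m (f k) = none → (∃ t, MoveRel m n (f k) t) →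
    f (k + 1) = σ (f k)

/-- Player `p` has a winning strategy from `s₀` on the `m × n` board: a legal
strategy guaranteeing that, against every play of the opponent, `p` wins after
finitely many moves. -/
def WinsFrom (m n : ℤ) (p : Player) (s₀ : PState) : Prop :=
  ∃ σ, LegalStrategy m n p σ ∧
    ∀ f, IsPlay m n f → f 0 = s₀ → Follows m n p σ f → ∃ k, winner m (f k) = some p

/-- Player `p` has a drawing strategy from `s₀` on the `m × n` board: a legal
strategy guaranteeing that the opponent never wins (play may continue forever). -/
def DrawsFrom (m n : ℤ) (p : Player) (s₀ : PState) : Prop :=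
  ∃ σ, LegalStrategy m n p σ ∧
    ∀ f, IsPlay m n f → f 0 = s₀ → Follows m n p σ f → ∀ k, winner m (f k) ≠ some (!p)

/-- A position is drawn if both players have drawing strategies from it. -/
def Drawn (m n : ℤ) (s : PState) : Prop :=
  DrawsFrom m n true s ∧ DrawsFrom m n false s

/-- The 24 chaps of the position `P0` on the 12 × 10 board:
c1, c2, c5, c7, c9, c10, c11, c12, d6, e4, e11, e12, f1, f2, f9, g7,
h1, h2, h3, h4, h6, h8, h11, h12. -/
def P0chaps : Finset (ℤ × ℤ) :=
  {(3, 1), (3, 2), (3, 5), (3, 7), (3, 9), (3, 10), (3, 11), (3, 12), (4, 6), (5, 4), (5, 11), (5, 12), (6, 1), (6, 2), (6, 9), (7, 7), (8, 1), (8, 2), (8, 3), (8, 4), (8, 6), (8, 8), (8, 11), (8, 12)}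

/-- The position `P0`: ball at a2 = (1, 2), the 24 chaps above, Alfred to move. -/
def P0 : PState := ⟨(1, 2), P0chaps, true⟩

/-- The position `P4`: `P0` with additional chaps at b3, c4, d5, e6, with Alfred to move. -/
def P4 : PState := ⟨(1, 2), P0chaps ∪ {(2, 3), (3, 4), (4, 5), (5, 6)}, true⟩

/-- The result of Alfred placing a chap at f7 = (6, 7) from `P4`. -/
def P4_f7 : PState := ⟨(1, 2), insert (6, 7) P4.chaps, false⟩

/-! ## Forced wins and safe positions -/

/-- Player `p` can force a win from the position within `n` turns. -/
inductive ForcedWin (p : Player) : ℕ → PState → Prop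
  | done {n s} : winner 12 s = some p → ForcedWin p n s
  | attack {n s t} : s.turn = p → winner 12 s = none → MoveRel 12 10 s t →
      ForcedWin p n t → ForcedWin p (n + 1) s
  | defend {n s} : s.turn = !p → winner 12 s = none → (∃ t, MoveRel 12 10 s t) →
      (∀ t, MoveRel 12 10 s t → ForcedWin p n t) → ForcedWin p (n + 1) s

theorem ForcedWin.mono {p : Player} {n : ℕ} {s : PState} (h : ForcedWin p n s) :
    ∀ {m : ℕ}, n ≤ m → ForcedWin p m s := by
  induction h with
  | done h => exact fun _ => .done h
  | attack h₁ h₂ h₃ _ ih =>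
    intro m hm
    obtain ⟨m, rfl⟩ : ∃ k, m = k + 1 := ⟨m - 1, by omega⟩
    exact .attack h₁ h₂ h₃ (ih (by omega))
  | defend h₁ h₂ h₃ _ ih =>
    intro m hm
    obtain ⟨m, rfl⟩ : ∃ k, m = k + 1 := ⟨m - 1, by omega⟩
    exact .defend h₁ h₂ h₃ fun t ht => ih t ht (by omega)

open Classical in
/-- Move to a position from which the win can be forced as fast as possible, if
there is one, and otherwise make any legal move. -/
noncomputable def fastestWin (p : Player) (s : PState) : PState :=
  if h : ∃ n t, MoveRel 12 10 s t ∧ ForcedWin p n t then (Nat.find_spec h).choose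
  else if h : ∃ t, MoveRel 12 10 s t then h.choose else s

open Classical in
theorem fastestWin_spec {p : Player} {s t : PState} {n : ℕ} (hm : MoveRel 12 10 s t)
    (ht : ForcedWin p n t) :
    ∃ m ≤ n, MoveRel 12 10 s (fastestWin p s) ∧ ForcedWin p m (fastestWin p s) := by
  have h : ∃ n t, MoveRel 12 10 s t ∧ ForcedWin p n t := ⟨n, t, hm, ht⟩
  refine ⟨Nat.find h, Nat.find_min' h ⟨t, hm, ht⟩, ?_⟩
  rw [fastestWin, dif_pos h]
  exact (Nat.find_spec h).choose_spec

theorem legalStrategy_fastestWin (p : Player) : LegalStrategy 12 10 p (fastestWin p) := by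
  intro s _ _ h
  by_cases h' : ∃ n t, MoveRel 12 10 s t ∧ ForcedWin p n t
  · obtain ⟨n, t, hm, ht⟩ := h'
    exact (fastestWin_spec hm ht).choose_spec.2.1
  · rw [fastestWin, dif_neg h', dif_pos h]
    exact h.choose_spec

theorem ForcedWin.winsFrom {p : Player} {n : ℕ} {s : PState} (h : ForcedWin p n s) :
    WinsFrom 12 10 p s := by
  refine ⟨fastestWin p, legalStrategy_fastestWin p, fun f hf h0 hσ => ?_⟩
  suffices H : ∀ n k, ForcedWin p n (f k) → ∃ k, winner 12 (f k) = some p from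
    H n 0 (h0 ▸ h)
  intro n
  induction n using Nat.strong_induction_on with
  | _ n ih =>
    intro k hk
    cases hk with
    | done hw => exact ⟨k, hw⟩
    | attack h₁ h₂ h₃ h₄ =>
      obtain ⟨m, hm, -, hw⟩ := fastestWin_spec h₃ h₄
      exact ih m (by omega) (k + 1) (hσ k h₁ h₂ ⟨_, h₃⟩ ▸ hw)
    | defend h₁ h₂ h₃ h₄ =>
      rcases hf k with ⟨-, -, hm⟩ | ⟨hw | hw, -⟩
      · exact ih _ (by omega) (k + 1) (h₄ _ hm)
      · exact absurd h₂ hw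
      · exact absurd h₃ hw

/-- A player cannot have a winning strategy from a position satisfying an invariant
that the opponent can maintain forever and that excludes a win of the player. -/
theorem not_winsFrom_of_invariant {p : Player} (I : PState → Prop) {s₀ : PState} (h₀ : I s₀)
    (hwin : ∀ s, I s → winner 12 s ≠ some p)
    (hmove : ∀ s, I s → winner 12 s = none → s.turn = p → ∀ t, MoveRel 12 10 s t → I t)
    (hreply : ∀ s, I s → winner 12 s = none → s.turn = !p → (∃ t, MoveRel 12 10 s t) →
      ∃ t, MoveRel 12 10 s t ∧ I t) :
    ¬ WinsFrom 12 10 p s₀ := by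
  classical
  rintro ⟨σ, hσ, H⟩
  have key : ∀ s, ∃ t, I s → I t ∧
      ((winner 12 s = none ∧ (∃ t, MoveRel 12 10 s t) ∧ MoveRel 12 10 s t ∧
        (s.turn = p → t = σ s)) ∨
      ((winner 12 s ≠ none ∨ ¬ ∃ t, MoveRel 12 10 s t) ∧ t = s)) := by
    intro s
    by_cases hs : winner 12 s = none ∧ ∃ t, MoveRel 12 10 s t
    · by_cases ht : s.turn = p
      · exact ⟨σ s, fun hI => ⟨hmove s hI hs.1 ht _ (hσ s ht hs.1 hs.2),
          .inl ⟨hs.1, hs.2, hσ s ht hs.1 hs.2, fun _ => rfl⟩⟩⟩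
      · by_cases hI : I s
        · obtain ⟨t, hm, hIt⟩ := hreply s hI hs.1 (by cases p <;> simpa using ht) hs.2
          exact ⟨t, fun _ => ⟨hIt, .inl ⟨hs.1, hs.2, hm, fun h => absurd h ht⟩⟩⟩
        · exact ⟨s, fun h => absurd h hI⟩
    · exact ⟨s, fun hI => ⟨hI, .inr ⟨by tauto, rfl⟩⟩⟩
  choose g hg using key
  let f : ℕ → PState := fun k => g^[k] s₀
  have hf : ∀ k, f (k + 1) = g (f k) := fun k => Function.iterate_succ_apply' g k s₀
  have hI : ∀ k, I (f k) := by
    intro k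
    induction k with
    | zero => exact h₀
    | succ k ih => rw [hf]; exact (hg _ ih).1
  obtain ⟨k, hk⟩ := H f
    (fun k => by
      rw [hf]
      rcases (hg _ (hI k)).2 with ⟨h₁, h₂, h₃, -⟩ | h
      · exact .inl ⟨h₁, h₂, h₃⟩
      · exact .inr h)
    rfl
    (fun k h₁ h₂ h₃ => by
      rw [hf]
      rcases (hg _ (hI k)).2 with ⟨-, -, -, h⟩ | ⟨h | h, -⟩
      · exact h h₁
      · exact absurd h₂ h
      · exact absurd h₃ h)
  exact hwin _ (hI k) hk

/-! ## Partially known positions -/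

theorem nat_beq_eq_false {i j : ℕ} : Nat.beq i j = false ↔ i ≠ j := by
  rw [← Bool.not_eq_true, Nat.beq_eq]

/-- The point with column `i % 100` and row `i / 100`; for example `pt 1203` is c12. -/
def pt (i : ℕ) : ℤ × ℤ := ((i % 100 : ℕ), (i / 100 : ℕ))

theorem pt_injective : Function.Injective pt := by
  intro i j h
  simp only [pt, Prod.mk.injEq, Nat.cast_inj] at h
  omega

/-- The codes of the eight directions: `(x, y)` is encoded as `(x + 1) + 100 * (y + 1)`. -/
def dirCodes : List ℕ := [0, 1, 2, 100, 102, 200, 201, 202]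

/-- The direction with a given code. -/
def dirVec (e : ℕ) : ℤ × ℤ := ((e % 100 : ℕ) - 1, (e / 100 : ℕ) - 1)

/-- The code of the neighbour of the point with code `i` in the direction with code `e`. -/
def next (i e : ℕ) : ℕ := i + e - 101

/-- The code of a point of the `12 × 10` board. -/
def inside (i : ℕ) : Bool :=
  Nat.ble 1 (i % 100) && Nat.ble (i % 100) 10 && Nat.ble 1 (i / 100) && Nat.ble (i / 100) 12

theorem onBoard_pt {i : ℕ} : OnBoard 12 10 (pt i) ↔ inside i = true := by
  simp only [OnBoard, pt, inside, Bool.and_eq_true, Nat.ble_eq]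
  omega

theorem exists_code {p : ℤ × ℤ} (h : OnBoard 12 10 p) : ∃ i, p = pt i := by
  obtain ⟨x, y⟩ := p
  simp only [OnBoard] at h
  refine ⟨(x + 100 * y).toNat, ?_⟩
  simp only [pt, Prod.mk.injEq]
  omega

theorem dirVec_mem {e : ℕ} (he : e ∈ dirCodes) : dirVec e ∈ dirs := by
  revert e
  decide

theorem exists_dirCode {d : ℤ × ℤ} (hd : d ∈ dirs) : ∃ e ∈ dirCodes, d = dirVec e := by
  revert d
  decide

theorem pt_next {i e : ℕ} (hi : inside i = true) (he : e ∈ dirCodes) :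
    pt (next i e) = ((pt i).1 + (dirVec e).1, (pt i).2 + (dirVec e).2) := by
  simp only [inside, Bool.and_eq_true, Nat.ble_eq] at hi
  simp only [dirCodes, List.mem_cons, List.not_mem_nil, or_false] at he
  simp only [pt, next, dirVec, Prod.mk.injEq]
  omega

theorem ray_zero (b d : ℤ × ℤ) : ray b d (0 : ℕ) = b := by
  simp [ray]

theorem ray_injective {b d : ℤ × ℤ} (hd : d ∈ dirs) : Function.Injective (ray b d) := by
  intro i j h
  have hd' : d.1 = 1 ∨ d.1 = -1 ∨ d.2 = 1 ∨ d.2 = -1 := by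
    clear h
    revert d
    decide
  simp only [ray, Prod.mk.injEq, add_right_inj] at h
  obtain ⟨h₁, h₂⟩ := h
  rcases hd' with hd' | hd' | hd' | hd' <;> simp only [hd'] at h₁ h₂ <;> omega

/-- Set difference of bit sets. -/
def diff (a b : ℕ) : ℕ := a ^^^ (a &&& b)

theorem testBit_diff (a b i : ℕ) : (diff a b).testBit i = (a.testBit i && !b.testBit i) := by
  simp only [diff, Nat.testBit_xor, Nat.testBit_and]
  cases a.testBit i <;> cases b.testBit i <;> rfl

theorem testBit_one_shiftLeft (i j : ℕ) : (1 <<< i).testBit j = decide (i = j) := by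
  rw [Nat.one_shiftLeft, Nat.testBit_two_pow]

/-- The bit set of a list of codes. -/
def bits (l : List ℕ) : ℕ := l.foldr (fun i a => 1 <<< i ||| a) 0

theorem testBit_bits {l : List ℕ} {i : ℕ} : (bits l).testBit i = true ↔ i ∈ l := by
  induction l with
  | nil => simp [bits]
  | cons a l ih =>
    rw [List.mem_cons, ← ih, @eq_comm _ i a]
    simp only [bits, List.foldr_cons, Nat.testBit_or, testBit_one_shiftLeft, Bool.or_eq_true,
      decide_eq_true_eq]

/-- Partial information about a position: the code of the ball, a bit set of points known
to carry chaps, and a bit set of points known to carry no chap. -/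
structure Pattern where
  ball : ℕ
  full : ℕ
  empty : ℕ

/-- The information in `P` is correct for the ball `b` and the chaps `c`. -/
def Pattern.Fits (P : Pattern) (b : ℤ × ℤ) (c : Finset (ℤ × ℤ)) : Prop :=
  b = pt P.ball ∧ (∀ i, P.full.testBit i = true → pt i ∈ c) ∧
    ∀ i, P.empty.testBit i = true → pt i ∉ c

/-- The pattern after a chap has been placed. -/
def Pattern.place (P : Pattern) (i : ℕ) : Pattern :=
  ⟨P.ball, P.full ||| 1 <<< i, diff P.empty (1 <<< i)⟩

theorem Pattern.Fits.place {P : Pattern} {b : ℤ × ℤ} {c : Finset (ℤ × ℤ)} (h : P.Fits b c)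
    (i : ℕ) : (P.place i).Fits b (insert (pt i) c) := by
  refine ⟨h.1, fun j hj => ?_, fun j hj => ?_⟩
  · simp only [Pattern.place, Nat.testBit_or, testBit_one_shiftLeft, Bool.or_eq_true,
      decide_eq_true_eq] at hj
    rcases hj with hj | rfl
    · exact Finset.mem_insert_of_mem (h.2.1 j hj)
    · exact Finset.mem_insert_self _ _
  · simp only [Pattern.place, testBit_diff, testBit_one_shiftLeft, Bool.and_eq_true,
      Bool.not_eq_true', decide_eq_false_iff_not] at hj
    rw [Finset.mem_insert, not_or]
    exact ⟨fun h' => hj.2 (pt_injective h').symm, h.2.2 j hj.1⟩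

theorem Pattern.Fits.insert_of_notMem {P : Pattern} {b p : ℤ × ℤ} {c : Finset (ℤ × ℤ)}
    (h : P.Fits b c) (hp : ∀ i, P.empty.testBit i = true → p ≠ pt i) : P.Fits b (insert p c) := by
  refine ⟨h.1, fun j hj => Finset.mem_insert_of_mem (h.2.1 j hj), fun j hj => ?_⟩
  rw [Finset.mem_insert, not_or]
  exact ⟨fun h' => hp j hj h'.symm, h.2.2 j hj⟩

/-- All positions fitting `Q` also fit `P`. -/
def Pattern.covers (P Q : Pattern) : Bool :=
  Nat.beq P.ball Q.ball && Nat.beq (P.full &&& Q.full) P.full &&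
    Nat.beq (P.empty &&& Q.empty) P.empty

theorem Pattern.Fits.of_covers {P Q : Pattern} {b : ℤ × ℤ} {c : Finset (ℤ × ℤ)}
    (h : Q.Fits b c) (hPQ : P.covers Q = true) : P.Fits b c := by
  simp only [Pattern.covers, Bool.and_eq_true, Nat.beq_eq] at hPQ
  obtain ⟨⟨h₁, h₂⟩, h₃⟩ := hPQ
  refine ⟨h₁ ▸ h.1, fun i hi => h.2.1 i ?_, fun i hi => h.2.2 i ?_⟩
  · rw [← h₂, Nat.testBit_and, Bool.and_eq_true] at hi
    exact hi.2
  · rw [← h₃, Nat.testBit_and, Bool.and_eq_true] at hi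
    exact hi.2

/-! ## Hops and jumps in partially known positions -/

/-- Remove the chaps on the line starting at `i` in direction `e` and move the ball behind
them. The result is `none` if the available information does not suffice or the fuel `n` is
used up. -/
def scan (e : ℕ) : ℕ → ℕ → ℕ → ℕ → Option Pattern
  | 0, _, _, _ => none
  | n + 1, i, full, empty =>
    if full.testBit i && inside i then
      scan e n (next i e) (diff full (1 <<< i)) (empty ||| 1 <<< i)
    else if empty.testBit i then some ⟨i, full, empty⟩ else none

theorem ray_next {i e : ℕ} (hi : inside i = true) (he : e ∈ dirCodes) (l : ℕ) :
    ray (pt (next i e)) (dirVec e) l = ray (pt i) (dirVec e) (l + 1 : ℕ) := by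
  rw [pt_next hi he]
  simp only [ray, Prod.mk.injEq]
  push_cast
  constructor <;> ring

theorem scan_spec {e : ℕ} (he : e ∈ dirCodes) {Q : Pattern} (n : ℕ) :
    ∀ (i full empty : ℕ) (c : Finset (ℤ × ℤ)),
      (∀ j, full.testBit j = true → pt j ∈ c) → (∀ j, empty.testBit j = true → pt j ∉ c) →
      scan e n i full empty = some Q →
      ∃ k : ℕ, (∀ l < k, ray (pt i) (dirVec e) l ∈ c) ∧ ray (pt i) (dirVec e) k ∉ c ∧
        Q.Fits (ray (pt i) (dirVec e) k)
          (c \ (Finset.range k).image fun l : ℕ => ray (pt i) (dirVec e) l) := by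
  induction n with
  | zero => simp [scan]
  | succ n ih =>
    intro i full empty c hf he' h
    rw [scan] at h
    split_ifs at h with h₁ h₂
    · rw [Bool.and_eq_true] at h₁
      obtain ⟨k, hk₁, hk₂, hk₃⟩ := ih _ _ _ (c.erase (pt i))
        (fun j hj => by
          simp only [testBit_diff, testBit_one_shiftLeft, Bool.and_eq_true,
            Bool.not_eq_true', decide_eq_false_iff_not] at hj
          exact Finset.mem_erase.2 ⟨fun h' => hj.2 (pt_injective h').symm, hf j hj.1⟩)
        (fun j hj => by
          simp only [Nat.testBit_or, testBit_one_shiftLeft, Bool.or_eq_true,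
            decide_eq_true_eq] at hj
          rw [Finset.mem_erase, not_and_or, not_not]
          rcases hj with hj | rfl
          · exact .inr (he' j hj)
          · exact .inl rfl)
        h
      simp only [ray_next h₁.2 he] at hk₁ hk₂ hk₃
      refine ⟨k + 1, fun l hl => ?_, fun h' => hk₂ (Finset.mem_erase.2 ⟨fun h'' => ?_, h'⟩), ?_⟩
      · cases l with
        | zero => rw [ray_zero]; exact hf i h₁.1
        | succ l => exact Finset.mem_of_mem_erase (hk₁ l (by omega))
      · have h₀ := h''.trans (ray_zero (pt i) (dirVec e)).symm
        have := Nat.cast_inj.1 (ray_injective (dirVec_mem he) h₀)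
        omega
      · convert hk₃ using 1
        rw [Finset.range_add_one', Finset.image_insert, ray_zero, Finset.sdiff_insert,
          ← Finset.erase_sdiff_comm, Finset.map_eq_image, Finset.image_image]
        rfl
    · rw [Option.some_inj] at h
      subst h
      refine ⟨0, by simp, ?_, ?_⟩
      · rw [ray_zero]; exact he' i h₂
      · rw [ray_zero]
        rw [Finset.range_zero, Finset.image_empty, Finset.sdiff_empty]
        exact ⟨rfl, hf, he'⟩

/-- Move the ball in direction `e` to the first free point, removing the chaps on its way. -/
def slide (P : Pattern) (e : ℕ) : Option Pattern :=
  if inside P.ball then scan e 14 (next P.ball e) P.full P.empty else none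

/-- Whether a ball that has been moved from `i` to `j` in direction `e` has made a legal hop. -/
def legal (i e j : ℕ) : Bool :=
  !Nat.beq j (next i e) && Nat.ble 1 (j % 100) && Nat.ble (j % 100) 10

theorem slide_spec {P Q : Pattern} {e : ℕ} {b : ℤ × ℤ} {c : Finset (ℤ × ℤ)}
    (hP : P.Fits b c) (he : e ∈ dirCodes) (h : slide P e = some Q) :
    ∃ k : ℕ, (∀ i : ℕ, 1 ≤ i → i ≤ k → ray b (dirVec e) i ∈ c) ∧
      ray b (dirVec e) (k + 1) ∉ c ∧
      Q.Fits (ray b (dirVec e) (k + 1))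
        (c \ Finset.image (fun i : ℕ => ray b (dirVec e) i) (Finset.Icc 1 k)) ∧
      (legal P.ball e Q.ball = true ↔
        1 ≤ k ∧ 1 ≤ (ray b (dirVec e) (k + 1)).1 ∧ (ray b (dirVec e) (k + 1)).1 ≤ 10) := by
  rw [slide] at h
  split_ifs at h with hi
  obtain ⟨k, hk₁, hk₂, hk₃⟩ := scan_spec he _ _ _ _ c hP.2.1 hP.2.2 h
  simp only [ray_next hi he, ← hP.1] at hk₁ hk₂ hk₃
  refine ⟨k, fun i h1 h2 => ?_, by exact_mod_cast hk₂, ?_, ?_⟩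
  · obtain ⟨i, rfl⟩ : ∃ j, i = j + 1 := ⟨i - 1, by omega⟩
    exact hk₁ i (by omega)
  · convert hk₃ using 1
    · norm_cast
    · congr 1
      ext x
      simp only [Finset.mem_image, Finset.mem_Icc, Finset.mem_range]
      constructor
      · rintro ⟨l, hl, rfl⟩
        exact ⟨l - 1, by omega, by rw [Nat.sub_add_cancel hl.1]⟩
      · rintro ⟨l, hl, rfl⟩
        exact ⟨l + 1, by omega, rfl⟩
  · have h1 : Q.ball = next P.ball e ↔ k = 0 := by
      rw [← pt_injective.eq_iff, ← hk₃.1, ← ray_zero (pt (next P.ball e)) (dirVec e),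
        ray_next hi he, ← hP.1, (ray_injective (dirVec_mem he)).eq_iff]
      omega
    have h2 := hk₃.1
    push_cast at h2
    rw [h2]
    simp only [legal, Bool.and_eq_true, Bool.not_eq_true', nat_beq_eq_false, ne_eq, h1,
      Nat.ble_eq, pt]
    omega

/-- A legal hop in direction `e`. -/
def hop (P : Pattern) (e : ℕ) : Option Pattern :=
  match slide P e with
  | none => none
  | some Q => if legal P.ball e Q.ball then some Q else none

theorem hop_spec {P Q : Pattern} {e : ℕ} {b : ℤ × ℤ} {c : Finset (ℤ × ℤ)}
    (hP : P.Fits b c) (he : e ∈ dirCodes) (h : hop P e = some Q) :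
    ∃ b' c', Hop 10 b c b' c' ∧ Q.Fits b' c' := by
  rw [hop] at h
  split at h
  · cases h
  · rename_i R hR
    split_ifs at h with hl
    cases h
    obtain ⟨k, h₁, h₂, h₃, h₄⟩ := slide_spec hP he hR
    obtain ⟨h₅, h₆, h₇⟩ := h₄.1 hl
    exact ⟨_, _, ⟨_, dirVec_mem he, k, h₅, h₁, h₂, h₆, h₇, rfl, rfl⟩, h₃⟩

theorem inside_of_slide {P Q : Pattern} {e : ℕ} (h : slide P e = some Q) :
    inside P.ball = true := by
  rw [slide] at h
  split_ifs at h with hi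
  exact hi

/-- Every hop is found by `slide`, provided that enough is known about the position. -/
theorem exists_slide_of_hop {P : Pattern} {b b' : ℤ × ℤ} {c c' : Finset (ℤ × ℤ)}
    (hP : P.Fits b c) (h : Hop 10 b c b' c') :
    ∃ e ∈ dirCodes, ∀ Q, slide P e = some Q → legal P.ball e Q.ball = true ∧ Q.Fits b' c' := by
  obtain ⟨d, hd, k, h₁, h₂, h₃, h₄, h₅, rfl, rfl⟩ := h
  obtain ⟨e, he, rfl⟩ := exists_dirCode hd
  refine ⟨e, he, fun Q hQ => ?_⟩
  obtain ⟨k', g₁, g₂, g₃, g₄⟩ := slide_spec hP he hQ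
  obtain rfl : k = k' := by
    rcases lt_trichotomy k k' with h | h | h
    · exact absurd (by exact_mod_cast g₁ (k + 1) (by omega) (by omega)) h₃
    · exact h
    · exact absurd (by exact_mod_cast h₂ (k' + 1) (by omega) (by omega)) g₂
  exact ⟨g₄.2 ⟨h₁, h₄, h₅⟩, g₃⟩

/-- Make the jump that consists of hops in the given directions. -/
def jumpTo : List ℕ → Pattern → Option Pattern
  | [], _ => none
  | e :: l, P =>
    if dirCodes.contains e then
      match hop P e with
      | none => none
      | some Q => if l.isEmpty then some Q else jumpTo l Q
    else none

theorem inside_of_jumpTo {l : List ℕ} {P Q : Pattern} (h : jumpTo l P = some Q) :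
    inside P.ball = true := by
  cases l with
  | nil => cases h
  | cons e l =>
    cases hs : slide P e with
    | none => simp [jumpTo, hop, hs] at h
    | some R => exact inside_of_slide hs

theorem jumpTo_spec {Q : Pattern} (l : List ℕ) :
    ∀ {P : Pattern} {b : ℤ × ℤ} {c : Finset (ℤ × ℤ)}, P.Fits b c → jumpTo l P = some Q →
      ∃ b' c', Jump 12 10 b c b' c' ∧ Q.Fits b' c' := by
  induction l with
  | nil => simp [jumpTo]
  | cons e l ih =>
    intro P b c hP h
    rw [jumpTo] at h
    by_cases he : dirCodes.contains e = true
    swap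
    · rw [if_neg he] at h
      cases h
    rw [if_pos he] at h
    rw [List.contains_iff_mem] at he
    split at h
    · cases h
    · rename_i R hR
      obtain ⟨b₁, c₁, h₁, h₂⟩ := hop_spec hP he hR
      by_cases hl : l.isEmpty = true
      · rw [if_pos hl] at h
        cases h
        exact ⟨_, _, .single h₁, h₂⟩
      · rw [if_neg hl] at h
        obtain ⟨b', c', h₃, h₄⟩ := ih h₂ h
        have hi := onBoard_pt.2 (inside_of_jumpTo h)
        rw [← h₂.1] at hi
        exact ⟨b', c', .cons h₁ hi.2.2.1 hi.2.2.2 h₃, h₄⟩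

/-- A move: place a chap or make a jump with hops in the given directions. -/
inductive Act
  | place (i : ℕ)
  | jump (l : List ℕ)

/-- The known part of the position after a move. -/
def Act.apply : Act → Pattern → Option Pattern
  | .place i, P =>
    if inside i && P.empty.testBit i && !Nat.beq i P.ball then some (P.place i) else none
  | .jump l, P => jumpTo l P

theorem Act.apply_spec {a : Act} {P Q : Pattern} {s : PState} (hP : P.Fits s.ball s.chaps)
    (h : a.apply P = some Q) :
    ∃ t, MoveRel 12 10 s t ∧ t.turn = !s.turn ∧ Q.Fits t.ball t.chaps := by
  cases a with
  | place i =>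
    rw [Act.apply] at h
    split_ifs at h with hi
    cases h
    simp only [Bool.and_eq_true, Bool.not_eq_true', nat_beq_eq_false] at hi
    obtain ⟨⟨h₁, h₂⟩, h₃⟩ := hi
    refine ⟨⟨s.ball, insert (pt i) s.chaps, !s.turn⟩, ⟨rfl, .inl ⟨pt i, onBoard_pt.2 h₁,
      hP.2.2 i h₂, ?_, rfl, rfl⟩⟩, rfl, hP.place i⟩
    rw [hP.1]
    exact pt_injective.ne h₃
  | jump l =>
    obtain ⟨b, c, h₁, h₂⟩ := jumpTo_spec l hP h
    exact ⟨⟨b, c, !s.turn⟩, ⟨rfl, .inr h₁⟩, rfl, h₂⟩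

/-! ## Checking all moves -/

/-- The winner if the ball rests at the point with code `i`. -/
def codeWinner (i : ℕ) : Option Player :=
  if Nat.ble 12 (i / 100) then some true else if Nat.ble (i / 100) 1 then some false else none

theorem Pattern.Fits.winner_eq {P : Pattern} {s : PState} (h : P.Fits s.ball s.chaps) :
    winner 12 s = codeWinner P.ball := by
  have h₁ : (12 : ℤ) ≤ (P.ball / 100 : ℕ) ↔ 12 ≤ P.ball / 100 := by norm_cast
  have h₂ : ((P.ball / 100 : ℕ) : ℤ) ≤ 1 ↔ P.ball / 100 ≤ 1 := by norm_cast
  simp only [winner, h.1, pt, codeWinner, Nat.ble_eq, h₁, h₂]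

/-- Every jump ends in a position where `p` has won or in a `good` one. -/
def jumpsOK (p : Player) (good : Pattern → Bool) : ℕ → Pattern → Bool
  | 0, _ => false
  | n + 1, P => dirCodes.all fun e =>
    match slide P e with
    | none => false
    | some Q => !legal P.ball e Q.ball ||
      ((codeWinner Q.ball == some p || good Q) && (!inside Q.ball || jumpsOK p good n Q))

theorem jumpsOK_spec {p : Player} {good : Pattern → Bool} {W : ℤ × ℤ → Finset (ℤ × ℤ) → Prop}
    (hW : ∀ Q b c, Q.Fits b c → (codeWinner Q.ball == some p || good Q) = true → W b c)
    {b b' : ℤ × ℤ} {c c' : Finset (ℤ × ℤ)} (hj : Jump 12 10 b c b' c') :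
    ∀ {n : ℕ} {P : Pattern}, P.Fits b c → jumpsOK p good n P = true → W b' c' := by
  have step {b b' : ℤ × ℤ} {c c' : Finset (ℤ × ℤ)} (h : Hop 10 b c b' c') {n : ℕ} {P : Pattern}
      (hP : P.Fits b c) (hn : jumpsOK p good n P = true) :
      ∃ m Q, Q.Fits b' c' ∧ (codeWinner Q.ball == some p || good Q) = true ∧
        (OnBoard 12 10 b' → jumpsOK p good m Q = true) := by
    cases n with
    | zero => cases hn
    | succ n =>
      obtain ⟨e, he, hQ⟩ := exists_slide_of_hop hP h
      have := List.all_eq_true.1 hn e he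
      split at this
      · cases this
      · rename_i Q hs
        obtain ⟨h₁, h₂⟩ := hQ Q hs
        rw [h₁, Bool.not_true, Bool.false_or, Bool.and_eq_true] at this
        refine ⟨n, Q, h₂, this.1, fun hb => ?_⟩
        rw [h₂.1, onBoard_pt] at hb
        simpa [hb] using this.2
  induction hj with
  | single h =>
    intro n P hP hn
    obtain ⟨m, Q, h₁, h₂, -⟩ := step h hP hn
    exact hW Q _ _ h₁ h₂
  | cons h h₁ h₂ _ ih =>
    intro n P hP hn
    obtain ⟨m, Q, h₃, -, h₄⟩ := step h hP hn
    refine ih h₃ (h₄ ⟨?_, ?_, h₁, h₂⟩)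
    · obtain ⟨d, -, k, -, -, -, h, -, rfl, -⟩ := h
      exact h
    · obtain ⟨d, -, k, -, -, -, -, h, rfl, -⟩ := h
      exact h

/-- The codes of all points of the board. -/
def boardCodes : List ℕ :=
  (List.range 12).flatMap fun y => (List.range 10).map fun x => 100 * y + x + 101

theorem mem_boardCodes {i : ℕ} (h : inside i = true) : i ∈ boardCodes := by
  simp only [inside, Bool.and_eq_true, Nat.ble_eq] at h
  simp only [boardCodes, List.mem_flatMap, List.mem_map, List.mem_range]
  exact ⟨i / 100 - 1, by omega, i % 100 - 1, by omega, by omega⟩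

theorem inside_of_mem_boardCodes {i : ℕ} (h : i ∈ boardCodes) : inside i = true := by
  simp only [boardCodes, List.mem_flatMap, List.mem_map, List.mem_range] at h
  obtain ⟨y, hy, x, hx, rfl⟩ := h
  simp only [inside, Bool.and_eq_true, Nat.ble_eq]
  omega

/-- Whether a chap can be placed on a point, as far as is known. -/
def Pattern.free (P : Pattern) (i : ℕ) : Bool :=
  P.empty.testBit i && !Nat.beq i P.ball

/-- Every placement of a chap leads to a `good` position. Points about which nothing is known
are taken care of by the position being `good` itself. -/
def placesOK (good : Pattern → Bool) (P : Pattern) : Bool :=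
  (boardCodes.all (fun i => P.empty.testBit i || P.full.testBit i) || good P) &&
    boardCodes.all fun i => !P.free i || good (P.place i)

theorem placesOK_spec {good : Pattern → Bool} {W : ℤ × ℤ → Finset (ℤ × ℤ) → Prop}
    (hW : ∀ Q b c, Q.Fits b c → good Q = true → W b c) {P : Pattern} {b q : ℤ × ℤ}
    {c : Finset (ℤ × ℤ)} (hP : P.Fits b c) (h : placesOK good P = true)
    (hq : OnBoard 12 10 q) (hqc : q ∉ c) (hqb : q ≠ b) : W b (insert q c) := by
  rw [placesOK, Bool.and_eq_true, Bool.or_eq_true, List.all_eq_true, List.all_eq_true] at h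
  obtain ⟨h₁, h₂⟩ := h
  obtain ⟨i, rfl⟩ := exists_code hq
  have hi := mem_boardCodes (onBoard_pt.1 hq)
  by_cases hfree : P.empty.testBit i = true
  · have hib : i ≠ P.ball := fun h => hqb (by rw [hP.1, h])
    have := h₂ i hi
    rw [Pattern.free, hfree, Bool.true_and, Bool.not_not, Bool.or_eq_true] at this
    refine hW _ _ _ (hP.place i) (this.resolve_left fun h => hib (Nat.eq_of_beq_eq_true h))
  · refine hW _ _ _ (hP.insert_of_notMem fun j hj hij => hfree ?_) (h₁.resolve_left fun h => ?_)
    · rwa [pt_injective hij]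
    · have := h i hi
      rw [Bool.or_eq_true] at this
      exact hqc (hP.2.1 i (this.resolve_left hfree))

/-- Every move leads to a position where `p` has won or to a `good` one. -/
def movesOK (p : Player) (good : Pattern → Bool) (P : Pattern) : Bool :=
  jumpsOK p good 30 P && placesOK good P

theorem movesOK_spec {p : Player} {good : Pattern → Bool} {W : PState → Prop} {s t : PState}
    (hW : ∀ Q t, t.turn = !s.turn → Q.Fits t.ball t.chaps →
      (codeWinner Q.ball == some p || good Q) = true → W t)
    {P : Pattern} (hP : P.Fits s.ball s.chaps) (h : movesOK p good P = true)
    (hm : MoveRel 12 10 s t) : W t := by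
  rw [movesOK, Bool.and_eq_true] at h
  obtain ⟨b, c, u⟩ := t
  obtain ⟨hu, hm⟩ := hm
  dsimp only at hu hm
  subst hu
  rcases hm with ⟨q, h₁, h₂, h₃, rfl, rfl⟩ | hj
  · exact placesOK_spec (W := fun b c => W ⟨b, c, !s.turn⟩)
      (fun Q b c hQ hg => hW Q ⟨b, c, !s.turn⟩ rfl hQ (by rw [hg, Bool.or_true]))
      hP h.2 h₁ h₂ h₃
  · exact jumpsOK_spec (W := fun b c => W ⟨b, c, !s.turn⟩)
      (fun Q b c hQ hg => hW Q ⟨b, c, !s.turn⟩ rfl hQ hg) hj hP h.1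

/-! ## Rules -/

/-- A recommended move for the positions fitting a pattern. -/
structure Rule where
  pattern : Pattern
  act : Act

/-- One of the rules applies. -/
def applies (l : List Rule) (Q : Pattern) : Bool :=
  l.any fun r => r.pattern.covers Q

theorem exists_of_applies {l : List Rule} {Q : Pattern} {b : ℤ × ℤ} {c : Finset (ℤ × ℤ)}
    (hQ : Q.Fits b c) (h : applies l Q = true) : ∃ r ∈ l, r.pattern.Fits b c := by
  obtain ⟨r, hr, h⟩ := List.any_eq_true.1 h
  exact ⟨r, hr, hQ.of_covers h⟩

/-- Following the rule, `p` wins at once or reaches a position from which every move of the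
opponent makes one of the rules `l` applicable. -/
def Rule.wins (p : Player) (l : List Rule) (r : Rule) : Bool :=
  codeWinner r.pattern.ball == none &&
    match r.act.apply r.pattern with
    | none => false
    | some Q => codeWinner Q.ball == some p ||
      codeWinner Q.ball == none && boardCodes.any Q.free && movesOK p (applies l) Q

/-- Each rule forces a win using only the rules after it. -/
def rulesWin (p : Player) : List Rule → Bool
  | [] => true
  | r :: l => r.wins p l && rulesWin p l

theorem exists_move {P : Pattern} {s : PState} (hP : P.Fits s.ball s.chaps)
    (h : boardCodes.any P.free = true) : ∃ t, MoveRel 12 10 s t := by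
  obtain ⟨i, hi, h⟩ := List.any_eq_true.1 h
  rw [Pattern.free] at h
  obtain ⟨t, ht, -⟩ := Act.apply_spec (a := .place i) hP
    (if_pos (by rw [inside_of_mem_boardCodes hi, Bool.true_and, h]))
  exact ⟨t, ht⟩

theorem forcedWin_of_rulesWin {p : Player} (l : List Rule) :
    rulesWin p l = true → ∀ r ∈ l, ∀ s : PState, s.turn = p → r.pattern.Fits s.ball s.chaps →
      ForcedWin p (2 * l.length) s := by
  induction l with
  | nil => simp
  | cons r₀ l ih =>
    intro h r hr s hs hP
    rw [rulesWin, Bool.and_eq_true] at h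
    rw [List.length_cons, Nat.mul_add_one]
    rcases List.mem_cons.1 hr with rfl | hr
    · have h₁ := h.1
      rw [Rule.wins, Bool.and_eq_true, beq_iff_eq] at h₁
      obtain ⟨h₁, h₂⟩ := h₁
      split at h₂
      · cases h₂
      · rename_i Q hQ
        obtain ⟨t, ht, htp, htQ⟩ := Act.apply_spec hP hQ
        refine .attack hs (hP.winner_eq.trans h₁) ht ?_
        rw [Bool.or_eq_true, beq_iff_eq, Bool.and_eq_true, Bool.and_eq_true, beq_iff_eq] at h₂
        rcases h₂ with h₂ | ⟨⟨h₂, h₃⟩, h₄⟩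
        · exact .done (htQ.winner_eq.trans h₂)
        · refine .defend (by rw [htp, hs]) (htQ.winner_eq.trans h₂) (exists_move htQ h₃)
            fun u hu => movesOK_spec (fun R v hv hR hg => ?_) htQ h₄ hu
          rw [Bool.or_eq_true, beq_iff_eq] at hg
          rcases hg with hg | hg
          · exact .done (hR.winner_eq.trans hg)
          · obtain ⟨r, hr, hr'⟩ := exists_of_applies hR hg
            exact ih h.2 r hr v (by rw [hv, htp, Bool.not_not, hs]) hr'
    · exact (ih h.2 r hr s hs hP).mono (by omega)

/-! ## The rules for the position -/

/-- The points of the board and their neighbours. -/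
def region : ℕ :=
  bits ((List.range 14).flatMap fun y => (List.range 12).map fun x => 100 * y + x)

/-- The neighbours of the board. -/
def border : ℕ :=
  diff region (bits boardCodes)

/-- The rule for positions with the ball at `b`, chaps at the points in `full`, and no chaps at
the points in `empty`. -/
def rule (b : ℕ) (full empty : List ℕ) (a : Act) : Rule :=
  ⟨⟨b, bits full, bits empty ||| border⟩, a⟩

/-- How Alfred exploits mistakes of Betty. -/
def alfredRules : List Rule := [
  rule 1110 [302, 403, 504, 605, 706, 807, 908, 1009, 1108, 1207, 1208]
    [201, 910, 1010, 1107, 1109, 1209, 1210]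
    (.place 201),
  rule 1110 [1009, 1010, 1108, 1207]
    [910]
    (.jump [1, 200]),
  rule 1110 [302, 403, 504, 605, 706, 807, 908, 1009, 1107, 1108, 1205]
    [201, 910, 1010, 1106, 1109, 1207, 1209, 1210]
    (.place 201),
  rule 1110 [1107, 1108, 1109, 1205]
    [1106]
    (.jump [100, 200]),
  rule 1110 [302, 403, 503, 504, 604, 605, 608, 703, 706, 707, 807, 808, 903, 906, 908, 910, 1003,
    1009, 1103, 1105, 1108, 1203, 1205, 1208]
    [101, 102, 201, 202, 301, 303, 304, 402, 404, 502, 505, 506, 507, 508, 509, 510, 602, 603,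
    606, 607, 609, 610, 702, 704, 705, 708, 709, 710, 802, 803, 804, 806, 809, 810, 902, 904,
    905, 907, 909, 1002, 1004, 1005, 1006, 1008, 1010, 1104, 1106, 1107, 1109, 1110, 1204,
    1206, 1207, 1209, 1210]
    (.place 1209),
  rule 201 [503, 604, 608, 703, 707, 808, 903, 906, 910, 1003, 1103, 1105, 1108, 1203, 1205, 1208,
    1209]
    [101, 102, 202, 301, 302, 303, 304, 402, 403, 404, 502, 504, 505, 506, 507, 508, 509, 510,
    602, 603, 605, 606, 607, 609, 610, 702, 704, 705, 706, 708, 709, 710, 802, 803, 804, 806,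
    807, 809, 810, 902, 904, 905, 907, 908, 909, 1002, 1004, 1005, 1006, 1008, 1009, 1010,
    1104, 1106, 1107, 1109, 1110, 1204, 1206, 1207, 1210]
    (.place 302),
  rule 201 [302, 503, 703, 803, 903, 1003, 1103, 1203]
    [403, 603]
    (.jump [202, 201, 201]),
  rule 201 [302, 503, 603, 703, 903, 1003, 1103, 1203]
    [403, 803]
    (.jump [202, 201, 201]),
  rule 201 [302, 403, 503, 604, 608, 703, 707, 808, 903, 906, 910, 1003, 1103, 1105, 1108, 1203, 1205,
    1208, 1209]
    [101, 102, 202, 301, 303, 304, 402, 404, 502, 504, 505, 506, 507, 508, 509, 510, 602, 603,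
    605, 606, 607, 609, 610, 702, 704, 705, 706, 708, 709, 710, 802, 803, 804, 806, 807, 809,
    810, 902, 904, 905, 907, 908, 909, 1002, 1004, 1005, 1006, 1008, 1009, 1010, 1104, 1106,
    1107, 1109, 1110, 1204, 1206, 1207, 1210]
    (.place 504),
  rule 201 [302, 403, 504, 604, 703, 803, 903, 1003, 1103, 1203]
    [603, 605]
    (.jump [202, 100, 201]),
  rule 201 [302, 403, 504, 605, 608, 707, 808, 906, 910, 1105, 1108, 1205, 1208, 1209]
    [101, 102, 202, 301, 506, 507, 508, 509, 510, 606, 607, 609, 610, 706, 708, 709, 710, 806,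
    807, 809, 810, 904, 905, 907, 908, 909, 1004, 1005, 1006, 1008, 1009, 1010, 1104, 1106,
    1107, 1109, 1110, 1206, 1207, 1210]
    (.place 706),
  rule 201 [302, 403, 504, 605, 706, 906, 1005, 1205]
    [807, 1104]
    (.jump [202, 200, 202]),
  rule 201 [302, 403, 504, 605, 706, 807, 910, 1108, 1208, 1209]
    [101, 102, 202, 301, 908, 909, 1008, 1009, 1010, 1106, 1107, 1109, 1110, 1206, 1207, 1210]
    (.place 908),
  rule 201 [302, 403, 504, 605, 706, 807, 908, 1108, 1207]
    [1009]
    (.jump [202, 200]),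
  rule 201 [302, 403, 504, 605, 706, 807, 908, 1009, 1209]
    [1110]
    (.jump [202, 200]),
  rule 201 [302, 403, 504, 605, 706, 807, 908, 1108]
    [1009, 1207]
    (.jump [202, 200]),
  rule 201 [302, 403, 504, 605, 706, 906, 1105, 1205]
    [807, 1005]
    (.jump [202, 200, 201]),
  rule 609 [808, 906, 910, 1105, 1108, 1205, 1208, 1209]
    [508, 509, 510, 608, 610, 706, 707, 708, 709, 710, 806, 807, 809, 810, 904, 905, 907, 908,
    909, 1004, 1005, 1006, 1008, 1009, 1010, 1104, 1106, 1107, 1109, 1110, 1206, 1207, 1210]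
    (.place 708),
  rule 607 [608, 808, 906, 910, 1105, 1108, 1205, 1208, 1209]
    [506, 507, 508, 509, 510, 606, 609, 610, 706, 707, 708, 709, 710, 806, 807, 809, 810, 904,
    905, 907, 908, 909, 1004, 1005, 1006, 1008, 1009, 1010, 1104, 1106, 1107, 1109, 1110, 1206,
    1207, 1210]
    (.place 708),
  rule 809 [910, 1108, 1208, 1209]
    [708, 709, 710, 808, 810, 908, 909, 1008, 1009, 1010, 1106, 1107, 1109, 1110, 1206, 1207,
    1210]
    (.place 909),
  rule 201 [302, 403, 504, 603, 604, 703, 903, 1103]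
    [602, 605, 804, 1002, 1204]
    (.jump [202, 100, 202, 200, 202]),
  rule 201 [302, 403, 504, 604, 703, 903, 1003, 1103, 1203]
    [603, 605, 803]
    (.jump [202, 100, 201, 201]),
  rule 201 [302, 503, 703, 903, 1003, 1103, 1203]
    [403, 603, 803]
    (.jump [202, 201, 201, 201]),
  rule 1110 [302, 403, 504, 605, 706, 807, 908, 1009, 1108, 1208]
    [201, 910, 1010, 1107, 1109, 1207, 1209, 1210]
    (.place 201),
  rule 1110 [1009, 1010, 1108]
    [910, 1207]
    (.jump [1, 200]),
  rule 1110 [201, 302, 403, 504, 605, 706, 807, 908, 1009]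
    [1010, 1109, 1209, 1210]
    (.place 1209),
  rule 605 [703, 903, 1003, 1103, 1203]
    [502, 503, 504, 505, 506, 602, 603, 604, 606, 702, 704, 705, 706, 802, 803, 804, 902, 904,
    1002, 1204]
    (.place 604),
  rule 605 [604, 703, 803, 903, 1003, 1103, 1203]
    [603]
    (.jump [100, 201]),
  rule 605 [603, 604, 703, 903, 1103]
    [602, 804, 1002, 1204]
    (.jump [100, 202, 200, 202]),
  rule 1110 [503, 504, 605, 703, 706, 803, 807, 903, 908, 1003, 1009, 1103, 1203]
    [403, 603]
    (.jump [0, 201, 201]),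
  rule 1110 [503, 504, 603, 605, 703, 706, 807, 903, 908, 1003, 1009, 1103, 1203]
    [403, 803]
    (.jump [0, 201, 201]),
  rule 1110 [503, 504, 605, 703, 706, 807, 903, 908, 1003, 1009, 1103, 1203]
    [403, 603, 803]
    (.jump [0, 201, 201, 201]),
  rule 609 [808, 906, 1105, 1108, 1205, 1208]
    [508, 509, 510, 608, 610, 706, 707, 708, 709, 710, 806, 807, 809, 810, 904, 905, 907, 908,
    909, 910, 1004, 1005, 1006, 1008, 1009, 1010, 1104, 1106, 1107, 1109, 1110, 1206, 1207,
    1209, 1210]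
    (.place 708),
  rule 609 [708, 906, 1005, 1205]
    [807, 1104]
    (.jump [200, 200, 202]),
  rule 609 [708, 807, 906, 1105, 1205]
    [1005]
    (.jump [200, 201]),
  rule 607 [608, 808, 906, 1105, 1108, 1205, 1208]
    [506, 507, 508, 509, 510, 606, 609, 610, 706, 707, 708, 709, 710, 806, 807, 809, 810, 904,
    905, 907, 908, 909, 910, 1004, 1005, 1006, 1008, 1009, 1010, 1104, 1106, 1107, 1109, 1110,
    1206, 1207, 1209, 1210]
    (.place 708),
  rule 607 [608, 708, 906, 1005, 1205]
    [609, 807, 1104]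
    (.jump [102, 200, 200, 202]),
  rule 607 [608, 708, 807, 906, 1105, 1205]
    [609, 1005]
    (.jump [102, 200, 201]),
  rule 607 [708, 808, 906, 1105, 1205]
    [807, 809, 1005]
    (.jump [202, 100, 200, 201]),
  rule 607 [608, 708, 906, 1105, 1205]
    [609, 807, 1005]
    (.jump [102, 200, 200, 201]),
  rule 809 [808, 906, 1105, 1205]
    [807, 1005]
    (.jump [100, 200, 201]),
  rule 609 [708, 906, 1105, 1205]
    [807, 1005]
    (.jump [200, 200, 201]),
  rule 1005 [1105, 1205]
    []
    (.jump [201]),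
  rule 809 [1108, 1208]
    [708, 709, 710, 808, 810, 908, 909, 910, 1008, 1009, 1010, 1106, 1107, 1109, 1110, 1206,
    1207, 1209, 1210]
    (.place 909),
  rule 809 [909, 1108, 1207]
    [1009]
    (.jump [201, 200]),
  rule 809 [909, 1009, 1208]
    [1109]
    (.jump [201, 200]),
  rule 809 [909, 1108]
    [1009, 1207]
    (.jump [201, 200]),
  rule 1009 [1108]
    [1207]
    (.jump [200]),
  rule 807 [906, 1105, 1205]
    [1005]
    (.jump [200, 201]),
  rule 1110 [906, 908, 1005, 1009, 1205]
    [807, 1104]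
    (.jump [0, 200, 202]),
  rule 1110 [906, 908, 1009, 1105, 1205]
    [807, 1005]
    (.jump [0, 200, 201]),
  rule 1110 [1210]
    []
    (.jump [201]),
  rule 1110 [1108, 1109, 1208]
    [1107]
    (.jump [100, 202]),
  rule 1110 [1010]
    [809, 810, 909, 910, 1009, 1109, 1110, 1209, 1210]
    (.place 1209),
  rule 910 [1209]
    [809, 810, 909, 1009, 1010, 1109, 1110, 1210]
    (.place 1010),
  rule 910 [1010, 1110]
    [1210]
    (.jump [201]),
  rule 910 [1010, 1209]
    [1110]
    (.jump [201, 200]),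
  rule 1110 []
    [1009, 1010, 1109, 1209, 1210]
    (.place 1209),
  rule 1110 [1209]
    []
    (.jump [200]),
  rule 403 [703, 903, 1003, 1103, 1203]
    [302, 303, 304, 402, 404, 502, 503, 504, 602, 603, 604, 702, 704, 802, 803, 804, 902, 904]
    (.place 503),
  rule 403 [503, 703, 803, 903, 1003, 1103, 1203]
    [603]
    (.jump [201, 201]),
  rule 403 [503, 603, 703, 903, 1003, 1103, 1203]
    [803]
    (.jump [201, 201]),
  rule 403 [503, 703, 903, 1003, 1103, 1203]
    [603, 803]
    (.jump [201, 201, 201]),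
  rule 803 [903, 1003, 1103, 1203]
    []
    (.jump [201]),
  rule 603 [703, 903, 1003, 1103, 1203]
    [803]
    (.jump [201, 201]),
  rule 605 [604, 703, 903, 1003, 1103, 1203]
    [603, 803]
    (.jump [100, 201, 201]),
  rule 1110 [604, 703, 706, 803, 807, 903, 908, 1003, 1009, 1103, 1203]
    [603, 605]
    (.jump [0, 100, 201]),
  rule 1110 [603, 604, 703, 706, 807, 903, 908, 1009, 1103]
    [602, 605, 804, 1002, 1204]
    (.jump [0, 100, 202, 200, 202]),
  rule 1110 [604, 703, 706, 807, 903, 908, 1003, 1009, 1103, 1203]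
    [603, 605, 803]
    (.jump [0, 100, 201, 201])]

/-- How Betty exploits mistakes of Alfred. -/
def bettyRules : List Rule := [
  rule 908 [108, 208, 308, 408, 608]
    [407, 409, 507, 508, 509, 607, 609, 707, 708, 709, 807, 808, 809, 907, 909, 1007, 1008,
    1009]
    (.place 808),
  rule 908 [108, 208, 308, 408, 508, 608, 808]
    [708]
    (.jump [1, 1]),
  rule 908 [108, 208, 308, 408, 608, 708, 808]
    [508]
    (.jump [1, 1]),
  rule 908 [108, 208, 308, 408, 608, 808]
    [508, 708]
    (.jump [1, 1, 1]),
  rule 508 [108, 208, 308, 408]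
    []
    (.jump [1]),
  rule 708 [108, 208, 308, 408, 608]
    [508]
    (.jump [1, 1]),
  rule 706 [108, 208, 308, 408, 608, 707]
    [508, 708]
    (.jump [102, 1, 1]),
  rule 201 [108, 208, 302, 308, 403, 408, 504, 508, 605, 608, 707]
    [706, 708]
    (.jump [202, 102, 1]),
  rule 201 [208, 302, 403, 408, 504, 605, 608, 707, 708]
    [107, 309, 507, 706, 709]
    (.jump [202, 102, 0, 2, 0]),
  rule 201 [108, 208, 302, 308, 403, 408, 504, 605, 608, 707]
    [508, 706, 708]
    (.jump [202, 102, 1, 1])]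

/-- The pattern of the position with the given ball and chaps. -/
def exactPattern (b : ℕ) (l : List ℕ) : Pattern :=
  ⟨b, bits l, diff region (bits l)⟩

/-- The codes of the chaps in `P0`. -/
def P0codes : List ℕ :=
  [103, 203, 503, 703, 903, 1003, 1103, 1203, 604, 405, 1105, 1205, 106, 206, 906, 707, 108, 208,
    308, 408, 608, 808, 1108, 1208]

/-- The points between a2 and j11. -/
def diagonal : List ℕ :=
  [302, 403, 504, 605, 706, 807, 908, 1009]

/-- The codes of the chaps of `P0` and `k` further chaps on the diagonal. -/
def mainCodes (k : ℕ) : List ℕ :=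
  P0codes ++ diagonal.take k

/-- The position after `k` moves of the main line. -/
def mainPattern (k : ℕ) : Pattern :=
  exactPattern 201 (mainCodes k)

/-- The position after `k` moves of the main line, rotated by a half turn. -/
def mainPatternRotated (k : ℕ) : Pattern :=
  exactPattern 1110 ((mainCodes k).map fun i => 1311 - i)

/-- Alfred's moves in the main line, which repeats after eighteen moves. -/
def mainRules : List Rule := [
  ⟨mainPattern 0, .place 302⟩,
  ⟨mainPattern 2, .place 504⟩,
  ⟨mainPattern 4, .place 706⟩,
  ⟨mainPattern 6, .place 908⟩,
  ⟨mainPattern 8, .jump [202]⟩,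
  ⟨mainPatternRotated 1, .place 908⟩,
  ⟨mainPatternRotated 3, .place 706⟩,
  ⟨mainPatternRotated 5, .place 504⟩,
  ⟨mainPatternRotated 7, .place 302⟩]

/-- Following the rule, Alfred reaches a position in which Betty has not won and every move of
Betty leads to a position covered by the rules. -/
def Rule.holds (r : Rule) : Bool :=
  codeWinner r.pattern.ball == none &&
    match r.act.apply r.pattern with
    | none => false
    | some Q => codeWinner Q.ball != some false &&
      movesOK true (applies (mainRules ++ alfredRules)) Q

/-! ## The main theorem -/

theorem rulesWin_alfredRules : rulesWin true alfredRules = true := by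
  decide +kernel

theorem rulesWin_bettyRules : rulesWin false bettyRules = true := by
  decide +kernel

theorem holds_mainRules : mainRules.all Rule.holds = true := by
  decide +kernel

theorem movesOK_mainPattern_place :
    movesOK true (applies (mainRules ++ alfredRules)) ((mainPattern 4).place 706) = true := by
  decide +kernel

theorem movesOK_mainPattern_four :
    movesOK false (fun Q => applies bettyRules Q || Q.full.testBit 706) (mainPattern 4) = true := by
  decide +kernel

theorem chaps_P4 : P4.chaps = (mainCodes 4).toFinset.image pt := by
  decide +kernel

theorem fits_exactPattern (b : ℕ) (l : List ℕ) :
    (exactPattern b l).Fits (pt b) (l.toFinset.image pt) := by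
  refine ⟨rfl, fun i hi => Finset.mem_image_of_mem pt (List.mem_toFinset.2 (testBit_bits.1 hi)),
    fun i hi h => ?_⟩
  obtain ⟨j, hj, h⟩ := Finset.mem_image.1 h
  rw [pt_injective h, List.mem_toFinset, ← testBit_bits] at hj
  simp [exactPattern, testBit_diff, hj] at hi

theorem fits_P4 : (mainPattern 4).Fits P4.ball P4.chaps := by
  rw [chaps_P4]
  exact fits_exactPattern 201 _

theorem moveRel_P4_f7 : MoveRel 12 10 P4 P4_f7 :=
  ⟨rfl, .inl ⟨(6, 7), by simp [OnBoard], by decide, by decide, rfl, rfl⟩⟩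

/-- Positions with Alfred to move from which he has a forced win or is in the main line. -/
def AlfredSafe (s : PState) : Prop :=
  (∃ n, ForcedWin true n s) ∨
    s.turn = true ∧ ∃ r ∈ mainRules, r.pattern.Fits s.ball s.chaps

/-- Positions with Betty to move in which she has not won and cannot escape the positions that
are safe for Alfred. -/
def BettyBound (s : PState) : Prop :=
  s.turn = false ∧ winner 12 s ≠ some false ∧ ∀ t, MoveRel 12 10 s t → AlfredSafe t

theorem bettyBound_of_movesOK {P : Pattern} {s : PState} (hP : P.Fits s.ball s.chaps)
    (hs : s.turn = false) (hw : codeWinner P.ball ≠ some false)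
    (h : movesOK true (applies (mainRules ++ alfredRules)) P = true) : BettyBound s := by
  refine ⟨hs, hP.winner_eq ▸ hw, fun t ht => movesOK_spec (fun Q t htp hQ hg => ?_) hP h ht⟩
  rw [hs, Bool.not_false] at htp
  rw [Bool.or_eq_true, beq_iff_eq] at hg
  rcases hg with hg | hg
  · exact .inl ⟨0, .done (hQ.winner_eq.trans hg)⟩
  · obtain ⟨r, hr, hr'⟩ := exists_of_applies hQ hg
    rcases List.mem_append.1 hr with hr | hr
    · exact .inr ⟨htp, r, hr, hr'⟩
    · exact .inl ⟨_, forcedWin_of_rulesWin _ rulesWin_alfredRules r hr t htp hr'⟩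

theorem Rule.holds_spec {r : Rule} (hr : r ∈ mainRules) {s : PState} (hs : s.turn = true)
    (hP : r.pattern.Fits s.ball s.chaps) :
    winner 12 s = none ∧ ∃ t, MoveRel 12 10 s t ∧ BettyBound t := by
  have h := List.all_eq_true.1 holds_mainRules r hr
  rw [Rule.holds, Bool.and_eq_true, beq_iff_eq] at h
  obtain ⟨h₁, h₂⟩ := h
  refine ⟨hP.winner_eq.trans h₁, ?_⟩
  split at h₂
  · cases h₂
  · rename_i Q hQ
    rw [Bool.and_eq_true, bne_iff_ne] at h₂
    obtain ⟨t, ht, htp, htQ⟩ := Act.apply_spec hP hQ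
    exact ⟨t, ht, bettyBound_of_movesOK htQ (by rw [htp, hs, Bool.not_true]) h₂.1 h₂.2⟩

theorem ForcedWin.winner_ne {p : Player} {n : ℕ} {s : PState} (h : ForcedWin p n s) :
    winner 12 s ≠ some (!p) := by
  cases h with
  | done h => rw [h]; cases p <;> decide
  | attack _ h => rw [h]; exact nofun
  | defend _ h => rw [h]; exact nofun

theorem not_winsFrom_P4_f7 : ¬ WinsFrom 12 10 false P4_f7 := by
  refine not_winsFrom_of_invariant (fun s => AlfredSafe s ∨ BettyBound s) (.inr ?_) ?_ ?_ ?_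
  · refine bettyBound_of_movesOK (fits_P4.place 706) rfl ?_ movesOK_mainPattern_place
    decide
  · rintro s ((⟨n, h⟩ | ⟨hs, r, hr, hP⟩) | h)
    · exact h.winner_ne
    · rw [(Rule.holds_spec hr hs hP).1]; exact nofun
    · exact h.2.1
  · rintro s ((⟨n, h⟩ | ⟨hs, -⟩) | h) hw hp t ht
    · cases h with
      | done h => rw [hw] at h; cases h
      | attack h => rw [hp] at h; cases h
      | defend _ _ _ h => exact .inl (.inl ⟨_, h t ht⟩)
    · rw [hp] at hs; cases hs
    · exact .inl (h.2.2 t ht)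
  · rintro s ((⟨n, h⟩ | ⟨hs, r, hr, hP⟩) | h) hw hp -
    · cases h with
      | done h => rw [hw] at h; cases h
      | attack _ _ ht h => exact ⟨_, ht, .inl (.inl ⟨_, h⟩)⟩
      | defend h => rw [hp] at h; cases h
    · obtain ⟨t, ht, h⟩ := (Rule.holds_spec hr hs hP).2
      exact ⟨t, ht, .inr h⟩
    · rw [h.1] at hp; cases hp

theorem Jump.subset {m n : ℤ} {b b' : ℤ × ℤ} {c c' : Finset (ℤ × ℤ)} (h : Jump m n b c b' c') :
    c' ⊆ c := by
  induction h with
  | single h =>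
    obtain ⟨d, -, k, -, -, -, -, -, -, rfl⟩ := h
    exact Finset.sdiff_subset
  | cons h _ _ _ ih =>
    obtain ⟨d, -, k, -, -, -, -, -, -, rfl⟩ := h
    exact ih.trans Finset.sdiff_subset

theorem eq_P4_f7 {t : PState} (ht : MoveRel 12 10 P4 t) (h : pt 706 ∈ t.chaps) : t = P4_f7 := by
  obtain ⟨b, c, u⟩ := t
  obtain ⟨hu, ⟨q, -, -, -, hb, hc⟩ | hj⟩ := ht
  · dsimp only at hu hb hc h
    subst hu hb hc
    rcases Finset.mem_insert.1 h with rfl | h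
    · rfl
    · exact absurd h (by decide)
  · exact absurd (hj.subset h) (by decide)

theorem winsFrom_of_ne_P4_f7 {t : PState} (ht : MoveRel 12 10 P4 t) (h : t ≠ P4_f7) :
    WinsFrom 12 10 false t := by
  suffices H : (∃ n, ForcedWin false n t) ∨ pt 706 ∈ t.chaps from
    (H.resolve_right fun h' => h (eq_P4_f7 ht h')).elim fun _ h => h.winsFrom
  refine movesOK_spec (W := fun t => (∃ n, ForcedWin false n t) ∨ pt 706 ∈ t.chaps)
    (fun Q t htp hQ hg => ?_) fits_P4 movesOK_mainPattern_four ht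
  rw [Bool.or_eq_true, beq_iff_eq, Bool.or_eq_true] at hg
  rcases hg with hg | hg | hg
  · exact .inl ⟨0, .done (hQ.winner_eq.trans hg)⟩
  · obtain ⟨r, hr, hr'⟩ := exists_of_applies hQ hg
    exact .inl ⟨_, forcedWin_of_rulesWin _ rulesWin_bettyRules r hr t htp hr'⟩
  · exact .inr (hQ.2.1 706 hg)

/-- From `P4`, placing a chap at f7 is Alfred's unique non-losing move:
it is a legal move; after it, Betty has no winning strategy from the resulting
position; and every other legal move of Alfred from `P4` leads to a position
from which Betty has a winning strategy. -/
theorem P4_unique_nonlosing :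
    MoveRel 12 10 P4 P4_f7 ∧
    ¬ WinsFrom 12 10 false P4_f7 ∧
    ∀ t, MoveRel 12 10 P4 t → t ≠ P4_f7 → WinsFrom 12 10 false t :=
  ⟨moveRel_P4_f7, not_winsFrom_P4_f7, fun _ => winsFrom_of_ne_P4_f7⟩
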